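/- Let n ∈ ℕ, κ > 0, η₁, η₂ > 0, let τ, σ ⊂ ℝⁿ be axis-parallel boxes with dist(τ,σ) > 0 and midpoints m_τ ≠ m_σ, and let c ∈ ℝⁿ satisfy the directional admissibility condition κ‖(m_τ−m_σ)/‖m_τ−m_σ‖ − c‖ ≤ η₁/max{diam τ, diam σ} and the parabolic admissibility condition κ·max{diam² τ, diam² σ} ≤ η₂·dist(τ,σ). Let d, p ∈ ℝⁿ with p ≠ 0 satisfy 2‖p‖ ≤ max{diam τ, diam σ} and d − tp ∈ τ−σ := {x−y : x ∈ τ, y ∈ σ} for all t ∈ [−1,1]. Then for all t ∈ [−1,1]: ‖(d−tp)/‖d−tp‖ − c‖ ≤ (η₁+η₂)/(2κ‖p‖). -/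

import Mathlib

open Complex Set

/-- The Euclidean norm on `ℝⁿ`. -/
noncomputable def euclNorm {n : ℕ} (x : Fin n → ℝ) : ℝ := Real.sqrt (∑ j, (x j) ^ 2)

/-- The axis-parallel box `[a₁,b₁] × ⋯ × [a_n,b_n]`. -/
def boxSet {n : ℕ} (a b : Fin n → ℝ) : Set (Fin n → ℝ) := {x | ∀ ι, x ι ∈ Set.Icc (a ι) (b ι)}

/-- The Euclidean diameter of a set. -/
noncomputable def euclDiam {n : ℕ} (s : Set (Fin n → ℝ)) : ℝ :=
  sSup {r : ℝ | ∃ x ∈ s, ∃ y ∈ s, r = euclNorm (x - y)}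

/-- The Euclidean distance between two sets. -/
noncomputable def euclSetDist {n : ℕ} (s t : Set (Fin n → ℝ)) : ℝ :=
  sInf {r : ℝ | ∃ x ∈ s, ∃ y ∈ t, r = euclNorm (x - y)}

/-- The midpoint of an axis-parallel box. -/
noncomputable def midpt {n : ℕ} (a b : Fin n → ℝ) : Fin n → ℝ := fun ι => (a ι + b ι) / 2

/-- Normalising vectors is Lipschitz with constant `1 / δ` outside the ball of radius `δ`. -/
theorem norm_inv_smul_sub_inv_smul_le {E : Type*} [NormedAddCommGroup E] [InnerProductSpace ℝ E]
    {δ : ℝ} (hδ : 0 < δ) {u w : E} (hu : δ ≤ ‖u‖) (hw : δ ≤ ‖w‖) :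
    ‖‖u‖⁻¹ • u - ‖w‖⁻¹ • w‖ ≤ ‖u - w‖ / δ := by
  have hu0 : 0 < ‖u‖ := hδ.trans_le hu
  have hw0 : 0 < ‖w‖ := hδ.trans_le hw
  rw [le_div_iff₀ hδ]
  refine abs_le_of_sq_le_sq' ?_ (norm_nonneg _) |>.2
  set q : ℝ := inner ℝ (‖u‖⁻¹ • u) (‖w‖⁻¹ • w) with hq
  have hu1 : ‖‖u‖⁻¹ • u‖ = 1 := by
    rw [norm_smul, norm_inv, norm_norm, inv_mul_cancel₀ hu0.ne']
  have hw1 : ‖‖w‖⁻¹ • w‖ = 1 := by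
    rw [norm_smul, norm_inv, norm_norm, inv_mul_cancel₀ hw0.ne']
  have hq1 : q ≤ 1 := by
    have h := real_inner_le_norm (‖u‖⁻¹ • u) (‖w‖⁻¹ • w)
    rwa [hu1, hw1, one_mul] at h
  have hinner : inner ℝ u w = ‖u‖ * ‖w‖ * q := by
    rw [hq, real_inner_smul_left, real_inner_smul_right]
    field_simp
  rw [mul_pow, norm_sub_sq_real, norm_sub_sq_real, hu1, hw1, ← hq, hinner]
  have hprod : δ ^ 2 ≤ ‖u‖ * ‖w‖ := by
    rw [sq]
    exact mul_le_mul hu hw hδ.le hu0.le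
  nlinarith [sq_nonneg (‖u‖ - ‖w‖), mul_nonneg (sub_nonneg.2 hprod) (sub_nonneg.2 hq1)]

theorem euclNorm_eq_norm {n : ℕ} (x : Fin n → ℝ) : euclNorm x = ‖WithLp.toLp 2 x‖ := by
  simp [euclNorm, EuclideanSpace.norm_eq]

theorem euclNorm_nonneg {n : ℕ} (x : Fin n → ℝ) : 0 ≤ euclNorm x := Real.sqrt_nonneg _

theorem euclNorm_pos {n : ℕ} {x : Fin n → ℝ} (hx : x ≠ 0) : 0 < euclNorm x := by
  rw [euclNorm_eq_norm, norm_pos_iff]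
  simpa using hx

theorem euclNorm_add_le {n : ℕ} (x y : Fin n → ℝ) :
    euclNorm (x + y) ≤ euclNorm x + euclNorm y := by
  simpa only [euclNorm_eq_norm, WithLp.toLp_add] using norm_add_le _ _

theorem euclNorm_sub_le {n : ℕ} (x y : Fin n → ℝ) :
    euclNorm (x - y) ≤ euclNorm x + euclNorm y := by
  simpa only [euclNorm_eq_norm, WithLp.toLp_sub] using norm_sub_le _ _

theorem euclNorm_smul {n : ℕ} (r : ℝ) (x : Fin n → ℝ) :
    euclNorm (r • x) = |r| * euclNorm x := by
  rw [euclNorm_eq_norm, euclNorm_eq_norm, WithLp.toLp_smul, norm_smul, Real.norm_eq_abs]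

theorem euclNorm_mono {n : ℕ} {x y : Fin n → ℝ} (h : ∀ j, |x j| ≤ y j) :
    euclNorm x ≤ euclNorm y :=
  Real.sqrt_le_sqrt (Finset.sum_le_sum fun j _ => sq_le_sq' (abs_le.1 (h j)).1 (abs_le.1 (h j)).2)

theorem euclDiam_nonneg {n : ℕ} (s : Set (Fin n → ℝ)) : 0 ≤ euclDiam s := by
  refine Real.sSup_nonneg ?_
  rintro r ⟨x, -, y, -, rfl⟩
  exact euclNorm_nonneg _

theorem euclSetDist_le {n : ℕ} {s t : Set (Fin n → ℝ)} {x y : Fin n → ℝ} (hx : x ∈ s)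
    (hy : y ∈ t) : euclSetDist s t ≤ euclNorm (x - y) := by
  refine csInf_le ⟨0, ?_⟩ ⟨x, hx, y, hy, rfl⟩
  rintro r ⟨x, -, y, -, rfl⟩
  exact euclNorm_nonneg _

theorem midpt_mem_boxSet {n : ℕ} {a b : Fin n → ℝ} (h : ∀ ι, a ι ≤ b ι) :
    midpt a b ∈ boxSet a b := fun ι => by
  have := h ι
  constructor <;> simp only [midpt] <;> linarith

theorem euclNorm_sub_le_euclDiam_boxSet {n : ℕ} {a b : Fin n → ℝ} (h : ∀ ι, a ι ≤ b ι) :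
    euclNorm (b - a) ≤ euclDiam (boxSet a b) := by
  refine le_csSup ⟨euclNorm (b - a), ?_⟩
    ⟨b, fun ι => ⟨h ι, le_rfl⟩, a, fun ι => ⟨le_rfl, h ι⟩, rfl⟩
  rintro r ⟨x, hx, y, hy, rfl⟩
  refine euclNorm_mono fun j => ?_
  have hxj := hx j
  have hyj := hy j
  simp only [Pi.sub_apply, abs_le]
  constructor <;> linarith [hxj.1, hxj.2, hyj.1, hyj.2]

theorem euclNorm_sub_midpt_le {n : ℕ} {a b x : Fin n → ℝ} (h : ∀ ι, a ι ≤ b ι)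
    (hx : x ∈ boxSet a b) : euclNorm (x - midpt a b) ≤ euclDiam (boxSet a b) / 2 := by
  have hhalf : euclNorm (x - midpt a b) ≤ euclNorm ((1 / 2 : ℝ) • (b - a)) := by
    refine euclNorm_mono fun j => ?_
    have hxj := hx j
    simp only [Pi.sub_apply, Pi.smul_apply, smul_eq_mul, midpt, abs_le]
    constructor <;> linarith [hxj.1, hxj.2]
  rw [euclNorm_smul, abs_of_pos one_half_pos] at hhalf
  linarith [euclNorm_sub_le_euclDiam_boxSet h]

/-- approximate directions: under the directional and parabolic
admissibility conditions, `‖(d−tp)/‖d−tp‖ − c‖ ≤ (η₁+η₂)/(2κ‖p‖)` for all `t ∈ [−1,1]`. -/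
theorem stmt6 (n : ℕ) (κ η₁ η₂ : ℝ) (hκ : 0 < κ) (hη₁ : 0 < η₁) (hη₂ : 0 < η₂)
    (aτ bτ aσ bσ : Fin n → ℝ) (haτ : ∀ ι, aτ ι ≤ bτ ι) (haσ : ∀ ι, aσ ι ≤ bσ ι)
    (τ σ : Set (Fin n → ℝ)) (hτ : τ = boxSet aτ bτ) (hσ : σ = boxSet aσ bσ)
    (hdist : 0 < euclSetDist τ σ)
    (hmid : midpt aτ bτ ≠ midpt aσ bσ)
    (c : Fin n → ℝ)
    (hdir : κ * euclNorm ((euclNorm (midpt aτ bτ - midpt aσ bσ))⁻¹ •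
        (midpt aτ bτ - midpt aσ bσ) - c) ≤ η₁ / max (euclDiam τ) (euclDiam σ))
    (hpar : κ * max ((euclDiam τ) ^ 2) ((euclDiam σ) ^ 2) ≤ η₂ * euclSetDist τ σ)
    (d p : Fin n → ℝ) (hp : p ≠ 0)
    (hpb : 2 * euclNorm p ≤ max (euclDiam τ) (euclDiam σ))
    (hdtp : ∀ t ∈ Set.Icc (-1 : ℝ) 1, ∃ x ∈ τ, ∃ y ∈ σ, d - t • p = x - y) :
    ∀ t ∈ Set.Icc (-1 : ℝ) 1,
      euclNorm ((euclNorm (d - t • p))⁻¹ • (d - t • p) - c) ≤ (η₁ + η₂) / (2 * κ * euclNorm p) := by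
  intro t ht
  subst hτ hσ
  obtain ⟨x, hx, y, hy, hxy⟩ := hdtp t ht
  set D := max (euclDiam (boxSet aτ bτ)) (euclDiam (boxSet aσ bσ)) with hD
  set δ := euclSetDist (boxSet aτ bτ) (boxSet aσ bσ)
  set m := midpt aτ bτ - midpt aσ bσ with hm
  have hp0 : 0 < euclNorm p := euclNorm_pos hp
  have hD0 : 0 < D := by linarith
  have hmax : max (euclDiam (boxSet aτ bτ) ^ 2) (euclDiam (boxSet aσ bσ) ^ 2) = D ^ 2 := by
    rcases le_total (euclDiam (boxSet aτ bτ)) (euclDiam (boxSet aσ bσ)) with h | h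
    · rw [hD, max_eq_right h, max_eq_right (pow_le_pow_left₀ (euclDiam_nonneg _) h 2)]
    · rw [hD, max_eq_left h, max_eq_left (pow_le_pow_left₀ (euclDiam_nonneg _) h 2)]
  rw [hmax] at hpar
  have hδv : δ ≤ euclNorm (d - t • p) := hxy ▸ euclSetDist_le hx hy
  have hδm : δ ≤ euclNorm m :=
    euclSetDist_le (midpt_mem_boxSet haτ) (midpt_mem_boxSet haσ)
  have hvm : euclNorm (d - t • p - m) ≤ D := by
    have heq : d - t • p - m = (x - midpt aτ bτ) - (y - midpt aσ bσ) := by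
      rw [hxy, hm]
      abel
    rw [heq]
    have h1 := euclNorm_sub_midpt_le haτ hx
    have h2 := euclNorm_sub_midpt_le haσ hy
    have h3 := le_max_left (euclDiam (boxSet aτ bτ)) (euclDiam (boxSet aσ bσ))
    have h4 := le_max_right (euclDiam (boxSet aτ bτ)) (euclDiam (boxSet aσ bσ))
    linarith [euclNorm_sub_le (x - midpt aτ bτ) (y - midpt aσ bσ)]
  set v := d - t • p
  have hlip : euclNorm ((euclNorm v)⁻¹ • v - (euclNorm m)⁻¹ • m) ≤ D / δ := by
    refine le_trans ?_ (div_le_div_of_nonneg_right hvm hdist.le)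
    simp only [euclNorm_eq_norm, WithLp.toLp_sub, WithLp.toLp_smul] at hδv hδm ⊢
    exact norm_inv_smul_sub_inv_smul_le hdist hδv hδm
  have hpar' : κ * (D / δ) ≤ η₂ / D := by
    rw [le_div_iff₀ hD0, mul_div_assoc', div_mul_eq_mul_div, div_le_iff₀ hdist]
    linarith
  have htri := euclNorm_add_le ((euclNorm v)⁻¹ • v - (euclNorm m)⁻¹ • m)
    ((euclNorm m)⁻¹ • m - c)
  rw [sub_add_sub_cancel] at htri
  have hsum : κ * euclNorm ((euclNorm v)⁻¹ • v - c) ≤ (η₁ + η₂) / D := by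
    rw [add_div]
    have h1 := mul_le_mul_of_nonneg_left htri hκ.le
    have h2 := mul_le_mul_of_nonneg_left hlip hκ.le
    linarith
  have hfinal : (η₁ + η₂) / D ≤ (η₁ + η₂) / (2 * euclNorm p) := by gcongr
  rw [le_div_iff₀ (by positivity)]
  have h := hsum.trans hfinal
  rw [le_div_iff₀ (by positivity)] at h
  linarith
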